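/- arXiv:1209.2920 — 2 statements merged into one kernel-verified Lean document; each statement's English description precedes it below -/
import Mathlib

section
/- Let β be a real number. The inequality M(a,b) < β·(Q(a,b)/3 + 2·A(a,b)/3) + (1-β)·Q(a,b)^{1/3}·A(a,b)^{2/3} holds for all a, b > 0 with a ≠ b if and only if β ≥ 4/5. -/
noncomputable def M (a b : ℝ) : ℝ := (a - b) / (2 * Real.arsinh ((a - b) / (a + b)))
noncomputable def A (a b : ℝ) : ℝ := (a + b) / 2
noncomputable def Q (a b : ℝ) : ℝ := Real.sqrt ((a ^ 2 + b ^ 2) / 2)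

open Filter Topology

/-- For `a, b` with `(a - b) / (a + b) = v`, this is the cube root of `Q a b / A a b`. -/
noncomputable def qaRatioCbrt (v : ℝ) : ℝ := (1 + v ^ 2) ^ ((1 : ℝ) / 6)

lemma qaRatioCbrt_pos (v : ℝ) : 0 < qaRatioCbrt v := by
  unfold qaRatioCbrt; positivity

lemma qaRatioCbrt_pow_six (v : ℝ) : qaRatioCbrt v ^ 6 = 1 + v ^ 2 := by
  unfold qaRatioCbrt
  rw [← Real.rpow_natCast, ← Real.rpow_mul (by positivity)]
  norm_num

lemma sqrt_one_add_sq_eq (v : ℝ) : √(1 + v ^ 2) = qaRatioCbrt v ^ 3 := by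
  rw [← qaRatioCbrt_pow_six, show qaRatioCbrt v ^ 6 = (qaRatioCbrt v ^ 3) ^ 2 by ring]
  exact Real.sqrt_sq (pow_pos (qaRatioCbrt_pos v) 3).le

lemma qaRatioCbrt_zero : qaRatioCbrt 0 = 1 := by simp [qaRatioCbrt]

lemma qaRatioCbrt_neg (v : ℝ) : qaRatioCbrt (-v) = qaRatioCbrt v := by simp [qaRatioCbrt]

lemma one_lt_qaRatioCbrt {v : ℝ} (hv : 0 < v) : 1 < qaRatioCbrt v :=
  Real.one_lt_rpow (by nlinarith) (by norm_num)

lemma hasDerivAt_qaRatioCbrt (v : ℝ) :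
    HasDerivAt qaRatioCbrt (v / (3 * qaRatioCbrt v ^ 5)) v := by
  have hbase : HasDerivAt (fun x : ℝ => 1 + x ^ 2) (2 * v) v := by
    simpa using (hasDerivAt_pow 2 v).const_add 1
  have hne : (1 : ℝ) + v ^ 2 ≠ 0 := by positivity
  have hpow := hbase.rpow_const (p := (1 : ℝ) / 6) (Or.inl hne)
  refine HasDerivAt.congr_deriv (f := qaRatioCbrt) hpow ?_
  have hu := (qaRatioCbrt_pos v).ne'
  rw [Real.rpow_sub_one hne, ← qaRatioCbrt, ← qaRatioCbrt_pow_six]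
  field_simp
  ring

/-- Three times the right-hand side of the mean inequality, divided by `A a b`, as a function of
the cube root of `Q a b / A a b`. -/
noncomputable def tripleMix (β u : ℝ) : ℝ := β * u ^ 3 + 3 * (1 - β) * u + 2 * β

/-- The cofactor of `(u - 1) ^ 2` in the numerator of the derivative of
`arsinh v - 3 * v / tripleMix β (qaRatioCbrt v)`, with `u = qaRatioCbrt v`. -/
noncomputable def derivCofactor (β u : ℝ) : ℝ :=
  β ^ 2 * u ^ 6 + 2 * β ^ 2 * u ^ 5 + (-3 * β ^ 2 + 12 * β - 6) * u ^ 4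
    + (-4 * β ^ 2 + 18 * β - 12) * u ^ 3 + (4 * β ^ 2 + 6 * β - 9) * u ^ 2
    + (6 * β - 6) * u + (3 * β - 3)

lemma derivCofactor_one (β : ℝ) : derivCofactor β 1 = 45 * β - 36 := by
  unfold derivCofactor; ring

lemma derivCofactor_four_fifths_pos {u : ℝ} (hu : 1 < u) : 0 < derivCofactor (4 / 5) u := by
  have hfac : derivCofactor (4 / 5) u =
      (u - 1) * (16 * u ^ 5 + 48 * u ^ 4 + 90 * u ^ 3 + 86 * u ^ 2 + 45 * u + 15) / 25 := by
    unfold derivCofactor; ring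
  have hu' : 0 < u - 1 := sub_pos.2 hu
  rw [hfac]
  positivity

lemma hasDerivAt_arsinh_sub {β v : ℝ} (hD : tripleMix β (qaRatioCbrt v) ≠ 0) :
    HasDerivAt (fun x => Real.arsinh x - 3 * x / tripleMix β (qaRatioCbrt x))
      ((qaRatioCbrt v - 1) ^ 2 * derivCofactor β (qaRatioCbrt v) /
        (qaRatioCbrt v ^ 5 * tripleMix β (qaRatioCbrt v) ^ 2)) v := by
  have hU := hasDerivAt_qaRatioCbrt v
  have hden : HasDerivAt (fun x => tripleMix β (qaRatioCbrt x))
      ((β * qaRatioCbrt v ^ 2 + (1 - β)) * v / qaRatioCbrt v ^ 5) v := by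
    refine ((((hU.pow 3).const_mul β).add
      (hU.const_mul (3 * (1 - β)))).add_const (2 * β)).congr_deriv ?_
    have := (qaRatioCbrt_pos v).ne'
    push_cast
    field_simp
  have hquot := ((hasDerivAt_id v).const_mul 3).div hden hD
  refine ((Real.hasDerivAt_arsinh v).sub hquot).congr_deriv ?_
  have hne := (qaRatioCbrt_pos v).ne'
  have hv := qaRatioCbrt_pow_six v
  rw [sqrt_one_add_sq_eq]
  simp only [id]
  generalize qaRatioCbrt v = u at *
  field_simp
  have hv2 : v ^ 2 = u ^ 6 - 1 := by linarith
  unfold derivCofactor tripleMix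
  ring_nf
  simp only [hv2]
  ring

lemma three_mul_div_lt_arsinh {v : ℝ} (hv : 0 < v) :
    3 * v / tripleMix (4 / 5) (qaRatioCbrt v) < Real.arsinh v := by
  have hD (x : ℝ) : tripleMix (4 / 5) (qaRatioCbrt x) ≠ 0 := by
    have := qaRatioCbrt_pos x
    unfold tripleMix
    positivity
  have hmono := strictMonoOn_of_hasDerivWithinAt_pos (convex_Ici (0 : ℝ))
    (fun x _ => (hasDerivAt_arsinh_sub (hD x)).continuousAt.continuousWithinAt)
    (fun x _ => (hasDerivAt_arsinh_sub (hD x)).hasDerivWithinAt)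
    (fun x hx => by
      rw [interior_Ici] at hx
      have h1 := one_lt_qaRatioCbrt hx
      have h2 := derivCofactor_four_fifths_pos h1
      have h3 := sub_pos.2 h1
      have h4 := qaRatioCbrt_pos x
      have h5 := hD x
      positivity)
  have := hmono Set.self_mem_Ici hv.le hv
  simp at this
  linarith

lemma exists_arsinh_le {β : ℝ} (hβ : β < 4 / 5) : ∃ v : ℝ, 0 < v ∧ v < 1 ∧
    0 < tripleMix β (qaRatioCbrt v) ∧
    Real.arsinh v ≤ 3 * v / tripleMix β (qaRatioCbrt v) := by
  have hcont : ContinuousAt qaRatioCbrt 0 := (hasDerivAt_qaRatioCbrt 0).continuousAt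
  have hDcont : ContinuousAt (fun x => tripleMix β (qaRatioCbrt x)) 0 := by
    unfold tripleMix; fun_prop
  have hRcont : ContinuousAt (fun x => derivCofactor β (qaRatioCbrt x)) 0 := by
    unfold derivCofactor; fun_prop
  have hDev : ∀ᶠ x in 𝓝 (0 : ℝ), 0 < tripleMix β (qaRatioCbrt x) := by
    refine hDcont.eventually_const_lt ?_
    simp only [qaRatioCbrt_zero, tripleMix]
    linarith
  have hRev : ∀ᶠ x in 𝓝 (0 : ℝ), derivCofactor β (qaRatioCbrt x) < 0 := by
    refine hRcont.eventually_lt_const ?_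
    simp only [qaRatioCbrt_zero, derivCofactor_one]
    linarith
  obtain ⟨ε, hε, hball⟩ := Metric.eventually_nhds_iff.1 (hDev.and hRev)
  have hmin : 0 < min ε 1 / 2 := by positivity
  have hv1 : min ε 1 / 2 < 1 := by linarith [min_le_right ε 1]
  have hvε : min ε 1 / 2 < ε := by linarith [min_le_left ε 1]
  generalize min ε 1 / 2 = v at *
  have hmem (x : ℝ) (hx : x ∈ Set.Icc 0 v) : dist x 0 < ε := by
    rw [Real.dist_0_eq_abs, abs_of_nonneg hx.1]
    exact hx.2.trans_lt hvε
  have hanti := antitoneOn_of_hasDerivWithinAt_nonpos (convex_Icc (0 : ℝ) v)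
    (fun x hx => (hasDerivAt_arsinh_sub
      (hball (hmem x hx)).1.ne').continuousAt.continuousWithinAt)
    (fun x hx => (hasDerivAt_arsinh_sub
      (hball (hmem x (interior_subset hx))).1.ne').hasDerivWithinAt)
    (fun x hx => by
      have h1 := (hball (hmem x (interior_subset hx))).2.le
      have h2 := qaRatioCbrt_pos x
      exact div_nonpos_of_nonpos_of_nonneg
        (mul_nonpos_of_nonneg_of_nonpos (sq_nonneg _) h1) (by positivity))
  refine ⟨v, hmin, hv1, (hball (hmem v ⟨hmin.le, le_rfl⟩)).1, ?_⟩
  have := hanti ⟨le_rfl, hmin.le⟩ ⟨hmin.le, le_rfl⟩ hmin.le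
  simp at this
  linarith

lemma Q_eq_A_mul {a b : ℝ} (ha : 0 < a) (hb : 0 < b) :
    Q a b = A a b * qaRatioCbrt ((a - b) / (a + b)) ^ 3 := by
  have hA : 0 < A a b := by unfold A; positivity
  rw [← sqrt_one_add_sq_eq, Q, ← Real.sqrt_sq hA.le, ← Real.sqrt_mul (sq_nonneg _)]
  congr 1
  unfold A
  field_simp
  ring

lemma Q_rpow_mul_A_rpow {a b : ℝ} (ha : 0 < a) (hb : 0 < b) :
    Q a b ^ ((1 : ℝ) / 3) * A a b ^ ((2 : ℝ) / 3) =
      A a b * qaRatioCbrt ((a - b) / (a + b)) := by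
  have hA : 0 < A a b := by unfold A; positivity
  have hu := qaRatioCbrt_pos ((a - b) / (a + b))
  have hcube : (qaRatioCbrt ((a - b) / (a + b)) ^ 3) ^ ((1 : ℝ) / 3) =
      qaRatioCbrt ((a - b) / (a + b)) := by
    rw [← Real.rpow_natCast, ← Real.rpow_mul hu.le]
    norm_num
  rw [Q_eq_A_mul ha hb, Real.mul_rpow hA.le (by positivity), hcube, mul_right_comm,
    ← Real.rpow_add hA]
  norm_num

lemma M_eq_A_mul {a b : ℝ} (ha : 0 < a) (hb : 0 < b) :
    M a b = A a b * ((a - b) / (a + b) / Real.arsinh ((a - b) / (a + b))) := by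
  have hab : a + b ≠ 0 := by positivity
  unfold M A
  rw [div_div, mul_comm (a + b) (Real.arsinh _), ← div_div, div_mul_div_comm, ← div_div]
  field_simp

lemma M_lt_iff {a b : ℝ} (ha : 0 < a) (hb : 0 < b) (β : ℝ) :
    M a b < β * (Q a b / 3 + 2 * A a b / 3) +
        (1 - β) * (Q a b ^ ((1 : ℝ) / 3) * A a b ^ ((2 : ℝ) / 3)) ↔
      (a - b) / (a + b) / Real.arsinh ((a - b) / (a + b)) <
        tripleMix β (qaRatioCbrt ((a - b) / (a + b))) / 3 := by
  have hA : 0 < A a b := by unfold A; positivity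
  rw [Q_rpow_mul_A_rpow ha hb, M_eq_A_mul ha hb, Q_eq_A_mul ha hb]
  refine Iff.trans ?_ (mul_lt_mul_iff_right₀ hA)
  unfold tripleMix
  ring_nf

lemma tripleMix_mono {β γ u : ℝ} (h : β ≤ γ) (hu : 0 < u) : tripleMix β u ≤ tripleMix γ u := by
  have hdiff : tripleMix γ u - tripleMix β u = (γ - β) * ((u - 1) ^ 2 * (u + 2)) := by
    unfold tripleMix; ring
  have h' : 0 ≤ γ - β := sub_nonneg.2 h
  have : 0 ≤ (γ - β) * ((u - 1) ^ 2 * (u + 2)) := by positivity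
  linarith

lemma div_arsinh_lt_of_pos {β v : ℝ} (hβ : 4 / 5 ≤ β) (hv : 0 < v) :
    v / Real.arsinh v < tripleMix β (qaRatioCbrt v) / 3 := by
  have hu := qaRatioCbrt_pos v
  have hD : 0 < tripleMix (4 / 5) (qaRatioCbrt v) := by unfold tripleMix; positivity
  have hlt := three_mul_div_lt_arsinh hv
  have hmono := tripleMix_mono hβ hu
  rw [div_lt_iff₀ hD] at hlt
  have har := Real.arsinh_pos_iff.2 hv
  rw [div_lt_iff₀ har]
  nlinarith

lemma div_arsinh_lt {β v : ℝ} (hβ : 4 / 5 ≤ β) (hv : v ≠ 0) :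
    v / Real.arsinh v < tripleMix β (qaRatioCbrt v) / 3 := by
  rcases hv.lt_or_gt with h | h
  · simpa [Real.arsinh_neg, qaRatioCbrt_neg] using div_arsinh_lt_of_pos hβ (neg_pos.2 h)
  · exact div_arsinh_lt_of_pos hβ h

theorem stmt_3 (β : ℝ) :
    (∀ a b : ℝ, 0 < a → 0 < b → a ≠ b →
      M a b < β * (Q a b / 3 + 2 * A a b / 3) +
        (1 - β) * (Q a b ^ ((1 : ℝ)/3) * A a b ^ ((2 : ℝ)/3))) ↔
    β ≥ 4/5 := by
  constructor
  · intro h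
    by_contra! hβ
    obtain ⟨v, hv0, hv1, hD, hle⟩ := exists_arsinh_le hβ
    have hlt := h (1 + v) (1 - v) (by linarith) (by linarith) (fun h => by linarith)
    rw [M_lt_iff (by linarith) (by linarith),
      show (1 + v - (1 - v)) / (1 + v + (1 - v)) = v by ring,
      div_lt_iff₀ (Real.arsinh_pos_iff.2 hv0)] at hlt
    rw [le_div_iff₀ hD] at hle
    linarith
  · intro hβ a b ha hb hab
    rw [M_lt_iff ha hb]
    exact div_arsinh_lt hβ (div_ne_zero (sub_ne_zero.2 hab) (by positivity))
end

section
/- For all real numbers a, b > 0 with a ≠ b, the inequality λ₀·(C(a,b)/6 + 5·A(a,b)/6) + (1-λ₀)·C(a,b)^{1/6}·A(a,b)^{5/6} < M(a,b) holds, where λ₀ = (6 - 6·2^{1/6}·log(1+√2)) / (7 - 6·2^{1/6}·log(1+√2)). -/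
noncomputable def C (a b : ℝ) : ℝ := (a ^ 2 + b ^ 2) / (a + b)

open Real

lemma one_add_le_cubic_pow_six {t : ℝ} (h0 : 0 ≤ t) (h1 : t ≤ 1) :
    1 + t ≤ (1 + t / 6 - 7 / 125 * t ^ 2 + 3 / 200 * t ^ 3) ^ 6 := by
  have h2 : 0 ≤ 1 - t := sub_nonneg.2 h1
  have low : 0 ≤ t ^ 2 * (0.0806 - 0.0975 * t + 0.0402 * t ^ 2) := by
    have : 0 ≤ 0.0806 - 0.0975 * t + 0.0402 * t ^ 2 := by nlinarith [sq_nonneg (t - 1.2)]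
    positivity
  have drop (n : ℕ) : 0 ≤ t ^ n * (1 - t) := by positivity
  have nn (n : ℕ) : 0 ≤ t ^ n := by positivity
  linarith [low, nn 2, nn 3, nn 4, nn 5, nn 6, nn 7, nn 8, nn 9, nn 10, nn 11, nn 12, nn 13, nn 14,
    nn 15, nn 16, nn 17, nn 18, drop 5, drop 6, drop 7, drop 8, drop 9, drop 10, drop 11, drop 12,
    drop 13, drop 14, drop 15, drop 16, drop 17]

lemma rpow_one_sixth_le_cubic {t : ℝ} (h0 : 0 ≤ t) (h1 : t ≤ 1) :
    (1 + t) ^ ((1 : ℝ) / 6) ≤ 1 + t / 6 - 7 / 125 * t ^ 2 + 3 / 200 * t ^ 3 := by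
  have hP : 0 ≤ 1 + t / 6 - 7 / 125 * t ^ 2 + 3 / 200 * t ^ 3 := by
    have : 0 ≤ t ^ 3 := by positivity
    nlinarith
  calc (1 + t) ^ ((1 : ℝ) / 6)
      ≤ ((1 + t / 6 - 7 / 125 * t ^ 2 + 3 / 200 * t ^ 3) ^ 6) ^ ((1 : ℝ) / 6) :=
        rpow_le_rpow (by linarith) (one_add_le_cubic_pow_six h0 h1) (by norm_num)
    _ = _ := by
        rw [← rpow_natCast, ← rpow_mul hP]
        norm_num

lemma cubic_pow_four_lt {t : ℝ} (h0 : 0 < t) (h1 : t ≤ 1) :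
    (1 + t / 6 - 63 / 1250 * t ^ 2 + 27 / 2000 * t ^ 3) ^ 4 <
      (1 + t) * (1 - t / 6 + 189 / 1250 * t ^ 2 - 27 / 400 * t ^ 3) ^ 2 := by
  have h2 : 0 ≤ 1 - t := sub_nonneg.2 h1
  have drop (n : ℕ) : 0 ≤ t ^ n * (1 - t) := by positivity
  have nn (n : ℕ) : 0 ≤ t ^ n := by positivity
  have : 0 < t ^ 2 := by positivity
  linarith [nn 3, nn 4, nn 5, nn 6, nn 7, nn 8, nn 9, nn 10, nn 11, nn 12, drop 2, drop 3,
    drop 4, drop 5, drop 6, drop 7, drop 8, drop 9, drop 10, drop 11]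

lemma arsinh_mul_cubic_lt {v : ℝ} (h0 : 0 < v) (h1 : v ≤ 1) :
    arsinh v * (1 + v ^ 2 / 6 - 63 / 1250 * v ^ 4 + 27 / 2000 * v ^ 6) < v := by
  set H : ℝ → ℝ := fun x => 1 + x ^ 2 / 6 - 63 / 1250 * x ^ 4 + 27 / 2000 * x ^ 6 with hH
  have Hpos {x : ℝ} (hx0 : 0 ≤ x) (hx1 : x ≤ 1) : 0 < H x := by
    have h4 : x ^ 4 ≤ 1 := pow_le_one₀ hx0 hx1
    have h6 : 0 ≤ x ^ 6 := by positivity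
    simp only [hH]
    nlinarith [sq_nonneg x]
  have hd (x : ℝ) (hx : H x ≠ 0) : HasDerivAt (fun y => y / H y - arsinh y)
      ((1 - x ^ 2 / 6 + 189 / 1250 * x ^ 4 - 27 / 400 * x ^ 6) / H x ^ 2 - (√(1 + x ^ 2))⁻¹) x := by
    have hHd : HasDerivAt H (x / 3 - 126 / 625 * x ^ 3 + 81 / 1000 * x ^ 5) x := by
      have := ((((hasDerivAt_pow 2 x).div_const 6).const_add 1).sub
        ((hasDerivAt_pow 4 x).const_mul (63 / 1250))).add
        ((hasDerivAt_pow 6 x).const_mul (27 / 2000))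
      refine this.congr_deriv ?_
      norm_num
      ring
    refine (((hasDerivAt_id x).div hHd hx).sub (hasDerivAt_arsinh x)).congr_deriv ?_
    simp only [hH, id]
    ring
  have mono : StrictMonoOn (fun y => y / H y - arsinh y) (Set.Icc 0 1) := by
    refine strictMonoOn_of_deriv_pos (convex_Icc 0 1)
      (fun x hx => (hd x (Hpos hx.1 hx.2).ne').continuousAt.continuousWithinAt) fun x hx => ?_
    rw [interior_Icc] at hx
    have hHx := Hpos hx.1.le hx.2.le
    rw [(hd x hHx.ne').deriv, sub_pos, inv_eq_one_div,
      div_lt_div_iff₀ (by positivity) (by positivity), one_mul]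
    have hx2 : x ^ 2 ≤ 1 := pow_le_one₀ hx.1.le hx.2.le
    have hx6 : x ^ 6 ≤ 1 := pow_le_one₀ hx.1.le hx.2.le
    have hK : 0 ≤ 1 - x ^ 2 / 6 + 189 / 1250 * x ^ 4 - 27 / 400 * x ^ 6 := by
      have : 0 ≤ x ^ 4 := by positivity
      linarith
    refine lt_of_pow_lt_pow_left₀ 2 (by positivity) ?_
    rw [mul_pow, sq_sqrt (by positivity)]
    have := cubic_pow_four_lt (t := x ^ 2) (by have := hx.1; positivity) hx2
    simp only [hH]
    ring_nf at this ⊢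
    exact this
  have := mono (Set.left_mem_Icc.2 zero_le_one) ⟨h0.le, h1⟩ h0
  simp only [zero_div, arsinh_zero, sub_zero, sub_pos] at this
  exact (lt_div_iff₀ (Hpos h0.le h1)).1 this

lemma log_one_add_sqrt_two_lower : 0.877 ≤ log (1 + √2) := by
  rw [le_log_iff_exp_le (by positivity)]
  have h := exp_bound' (x := 0.877) (by norm_num) (by norm_num) (n := 8) (by norm_num)
  have hs : 1.414 ≤ √2 := le_sqrt_of_sq_le (by norm_num)
  norm_num [Finset.sum_range_succ, Nat.factorial] at h hs ⊢
  linarith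

lemma log_one_add_sqrt_two_upper : log (1 + √2) < 1 := by
  rw [log_lt_iff_lt_exp (by positivity)]
  have hs : √2 < 1.5 := by rw [sqrt_lt' (by norm_num)]; norm_num
  linarith [exp_one_gt_d9]

lemma coefficient_le :
    (6 - 6 * (2 : ℝ) ^ ((1 : ℝ) / 6) * log (1 + √2)) /
      (7 - 6 * (2 : ℝ) ^ ((1 : ℝ) / 6) * log (1 + √2)) ≤ 1 / 10 := by
  have hp : (1.12 : ℝ) ≤ 2 ^ ((1 : ℝ) / 6) := by
    rw [one_div, le_rpow_inv_iff_of_pos (by norm_num) (by norm_num) (by norm_num)]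
    norm_num
  have hp' : (2 : ℝ) ^ ((1 : ℝ) / 6) ≤ 7 / 6 := by
    have := rpow_one_add_le_one_add_mul_self (s := 1) (p := 1 / 6) (by norm_num) (by norm_num)
      (by norm_num)
    norm_num at this ⊢
    exact this
  have hL := log_one_add_sqrt_two_lower
  have hL' := log_one_add_sqrt_two_upper
  rw [div_le_div_iff₀ (by nlinarith) (by norm_num)]
  nlinarith

lemma combination_mul_arsinh_lt {l v : ℝ} (hl : l ≤ 1 / 10) (h0 : 0 < v) (h1 : v ≤ 1) :
    (l * (1 + v ^ 2 / 6) + (1 - l) * (1 + v ^ 2) ^ ((1 : ℝ) / 6)) * arsinh v < v := by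
  have hv1 : v ^ 2 ≤ 1 := pow_le_one₀ h0.le h1
  have bern : (1 + v ^ 2) ^ ((1 : ℝ) / 6) ≤ 1 + v ^ 2 / 6 := by
    have := rpow_one_add_le_one_add_mul_self (s := v ^ 2) (p := 1 / 6)
      (by linarith [sq_nonneg v]) (by norm_num) (by norm_num)
    linarith
  have cubic := rpow_one_sixth_le_cubic (sq_nonneg v) hv1
  refine lt_of_le_of_lt ?_ (arsinh_mul_cubic_lt h0 h1)
  rw [mul_comm]
  refine mul_le_mul_of_nonneg_left ?_ (arsinh_nonneg_iff.2 h0.le)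
  have := mul_nonneg (sub_nonneg.2 hl) (sub_nonneg.2 bern)
  ring_nf at this cubic ⊢
  linarith

lemma combination_lt_M_of_lt {l a b : ℝ} (hl : l ≤ 1 / 10) (hb : 0 < b) (hab : b < a) :
    l * (C a b / 6 + 5 * A a b / 6) +
      (1 - l) * (C a b ^ ((1 : ℝ) / 6) * A a b ^ ((5 : ℝ) / 6)) < M a b := by
  have hs : 0 < a + b := by linarith
  set v := (a - b) / (a + b) with hv
  have h0 : 0 < v := div_pos (sub_pos.2 hab) hs
  have h1 : v ≤ 1 := by rw [hv, div_le_one hs]; linarith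
  have hA : 0 < A a b := by unfold A; positivity
  have hC : C a b = A a b * (1 + v ^ 2) := by
    unfold C A
    rw [hv]
    field_simp
    ring
  have hM : M a b = A a b * v / arsinh v := by
    have : a - b = 2 * (A a b * v) := by
      unfold A
      rw [hv]
      field_simp
    unfold M
    rw [← hv, this, mul_div_mul_left _ _ two_ne_zero]
  have hG : C a b ^ ((1 : ℝ) / 6) * A a b ^ ((5 : ℝ) / 6) =
      A a b * (1 + v ^ 2) ^ ((1 : ℝ) / 6) := by
    rw [hC, mul_rpow hA.le (by positivity), mul_right_comm, ← rpow_add hA]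
    norm_num
  rw [hM, hG, hC, lt_div_iff₀ (arsinh_pos_iff.2 h0)]
  have := mul_lt_mul_of_pos_left (combination_mul_arsinh_lt hl h0 h1) hA
  linarith

lemma M_comm (a b : ℝ) : M a b = M b a := by
  unfold M
  rw [← neg_sub b a, add_comm a b, neg_div (b + a), arsinh_neg, mul_neg, neg_div_neg_eq]

lemma A_comm (a b : ℝ) : A a b = A b a := by
  unfold A
  rw [add_comm]

lemma C_comm (a b : ℝ) : C a b = C b a := by
  unfold C
  rw [add_comm a b, add_comm (a ^ 2)]

theorem stmt_4 (a b : ℝ) (ha : 0 < a) (hb : 0 < b) (hab : a ≠ b) :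
    (6 - 6 * (2 : ℝ) ^ ((1 : ℝ)/6) * Real.log (1 + Real.sqrt 2)) /
      (7 - 6 * (2 : ℝ) ^ ((1 : ℝ)/6) * Real.log (1 + Real.sqrt 2)) *
      (C a b / 6 + 5 * A a b / 6) +
    (1 - (6 - 6 * (2 : ℝ) ^ ((1 : ℝ)/6) * Real.log (1 + Real.sqrt 2)) /
      (7 - 6 * (2 : ℝ) ^ ((1 : ℝ)/6) * Real.log (1 + Real.sqrt 2))) *
      (C a b ^ ((1 : ℝ)/6) * A a b ^ ((5 : ℝ)/6)) < M a b := by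
  rcases lt_or_gt_of_ne hab with h | h
  · rw [M_comm, A_comm, C_comm]
    exact combination_lt_M_of_lt coefficient_le ha h
  · exact combination_lt_M_of_lt coefficient_le hb h
end
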